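/- arXiv:2205.13207 — 5 statements merged into one kernel-verified Lean document; each statement's English description precedes it below -/
import Mathlib

section
/- Let {μₙ} and μ be finite positive Borel measures on ℝ and let α ∈ ℝ be a continuity point of μ (i.e. μ({α}) = 0). If the distribution functions centred at α satisfy F_{μₙ}^{(α)}(x) → F_{μ}^{(α)}(x) at every continuity point x of μ, then μₙ → μ vaguely (i.e. ∫ f dμₙ → ∫ f dμ for every continuous f: ℝ → ℝ with compact support). -/
open MeasureTheory Filter Topology
open scoped ENNReal

/-- The distribution function of a finite positive Borel measure on ℝ, centred at α. -/
noncomputable def FcPos (μ : Measure ℝ) (α x : ℝ) : ℝ :=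
  if α ≤ x then (μ (Set.Ioc α x)).toReal else -(μ (Set.Ioc x α)).toReal

/-- The distribution function of a finite signed Borel measure on ℝ, centred at α. -/
noncomputable def Fc (μ : SignedMeasure ℝ) (α x : ℝ) : ℝ :=
  if α ≤ x then μ (Set.Ioc α x) else -μ (Set.Ioc x α)

/-- Integral of a real-valued function against a finite signed measure, via the
Hahn–Jordan decomposition `μ = μ⁺ - μ⁻`. -/
noncomputable def sInt {Ω : Type*} [MeasurableSpace Ω] (μ : SignedMeasure Ω) (f : Ω → ℝ) : ℝ :=
  (∫ x, f x ∂μ.toJordanDecomposition.posPart) - ∫ x, f x ∂μ.toJordanDecomposition.negPart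

/-- Vague convergence of signed measures on ℝ. -/
def VagueTendsto (μs : ℕ → SignedMeasure ℝ) (μ : SignedMeasure ℝ) : Prop :=
  ∀ f : ℝ → ℝ, Continuous f → HasCompactSupport f →
    Tendsto (fun n => sInt (μs n) f) atTop (𝓝 (sInt μ f))

/-- Vague convergence of positive measures on ℝ. -/
def VagueTendstoPos (μs : ℕ → Measure ℝ) (μ : Measure ℝ) : Prop :=
  ∀ f : ℝ → ℝ, Continuous f → HasCompactSupport f →
    Tendsto (fun n => ∫ x, f x ∂(μs n)) atTop (𝓝 (∫ x, f x ∂μ))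

/-- The sequence of signed measures has no mass at the point x. -/
def NoMassAt (μs : ℕ → SignedMeasure ℝ) (x : ℝ) : Prop :=
  ∀ ε : ℝ≥0∞, 0 < ε → ∃ N : Set ℝ, IsOpen N ∧ x ∈ N ∧
    limsup (fun n => (μs n).totalVariation N) atTop ≤ ε

theorem FcPos_eq_intervalIntegral (ν : Measure ℝ) (α x : ℝ) :
    FcPos ν α x = ∫ _ in α..x, (1 : ℝ) ∂ν := by
  unfold FcPos
  split_ifs with h
  · rw [intervalIntegral.integral_of_le h]
    simp [Measure.real]
  · rw [intervalIntegral.integral_of_ge (le_of_not_ge h)]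
    simp [Measure.real]

theorem FcPos_sub_FcPos (ν : Measure ℝ) [IsFiniteMeasure ν] (α x y : ℝ) :
    FcPos ν α y - FcPos ν α x = ∫ _ in x..y, (1 : ℝ) ∂ν := by
  rw [FcPos_eq_intervalIntegral, FcPos_eq_intervalIntegral]
  exact intervalIntegral.integral_interval_sub_left
    (intervalIntegrable_const) (intervalIntegrable_const)

/-- A Riemann–Stieltjes sum along a monotone sequence approximates the integral up to the
oscillation of the integrand times the total mass. -/
theorem abs_integral_sub_stieltjesSum_le (ν : Measure ℝ) [IsFiniteMeasure ν] (α : ℝ)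
    {f : ℝ → ℝ} (hf : Continuous f) {t : ℕ → ℝ} (ht : Monotone t) (N : ℕ) {ε : ℝ}
    (hosc : ∀ i, ∀ x ∈ Set.Ioc (t i) (t (i + 1)), |f x - f (t (i + 1))| ≤ ε) :
    |(∫ x in t 0..t N, f x ∂ν) -
        ∑ i ∈ Finset.range N, f (t (i + 1)) * (FcPos ν α (t (i + 1)) - FcPos ν α (t i))|
      ≤ ε * (FcPos ν α (t N) - FcPos ν α (t 0)) := by
  rw [← intervalIntegral.sum_integral_adjacent_intervals
      (fun k _ => hf.intervalIntegrable _ _), ← Finset.sum_sub_distrib,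
    ← Finset.sum_range_sub (fun i => FcPos ν α (t i)), Finset.mul_sum]
  refine (Finset.abs_sum_le_sum_abs _ _).trans (Finset.sum_le_sum fun i _ => ?_)
  have hle : t i ≤ t (i + 1) := ht i.le_succ
  rw [FcPos_sub_FcPos, ← intervalIntegral.integral_const_mul,
    ← intervalIntegral.integral_const_mul,
    ← intervalIntegral.integral_sub (hf.intervalIntegrable _ _) intervalIntegrable_const,
    ← Real.norm_eq_abs]
  refine intervalIntegral.norm_integral_le_of_norm_le hle
    (Eventually.of_forall fun x hx => ?_) intervalIntegrable_const
  simpa using hosc i x hx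

theorem dense_setOf_measure_singleton_eq_zero (μ : Measure ℝ) [IsFiniteMeasure μ] :
    Dense {x : ℝ | μ {x} = 0} := by
  have h : {x : ℝ | 0 < μ {x}}.Countable :=
    Measure.countable_meas_pos_of_disjoint_iUnion (fun x => measurableSet_singleton x)
      (fun x y hxy => by simpa using hxy)
  convert h.dense_compl ℝ using 1
  ext x
  simp

theorem stmt9 (μs : ℕ → Measure ℝ) (μ : Measure ℝ)
    [∀ n, IsFiniteMeasure (μs n)] [IsFiniteMeasure μ]
    (α : ℝ) (hα : μ {α} = 0)
    (hF : ∀ x : ℝ, μ {x} = 0 →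
      Tendsto (fun n => FcPos (μs n) α x) atTop (𝓝 (FcPos μ α x))) :
    VagueTendstoPos μs μ := by
  intro f hf hsupp
  obtain ⟨R, hR⟩ := hsupp.isCompact.isBounded.subset_closedBall 0
  rw [Metric.tendsto_nhds]
  intro η hη
  obtain ⟨C, hC⟩ : ∃ C, C = μ.real Set.univ := ⟨_, rfl⟩
  have hC0 : 0 ≤ C := hC ▸ measureReal_nonneg
  obtain ⟨ε, hε, hεη⟩ : ∃ ε > 0, ε * (2 * C + 2) < η :=
    ⟨η / (2 * (2 * C + 2)), by positivity, by field_simp; norm_num⟩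
  obtain ⟨δ, hδ, hfδ⟩ :=
    Metric.uniformContinuous_iff.1 (hsupp.uniformContinuous_of_continuous hf) ε hε
  have hgrid (i : ℕ) : ∃ x ∈ {x : ℝ | μ {x} = 0},
      x ∈ Set.Ioo (-R + (i - 1) * (δ / 2)) (-R + i * (δ / 2)) :=
    (dense_setOf_measure_singleton_eq_zero μ).exists_mem_open isOpen_Ioo
      (Set.nonempty_Ioo.2 (by linarith))
  choose t ht0 ht using hgrid
  have hmono : Monotone t := monotone_nat_of_le_succ fun i => by
    have h1 := (ht i).2
    have h2 := (ht (i + 1)).1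
    push_cast at h2
    rw [add_sub_cancel_right] at h2
    linarith
  obtain ⟨N, hN⟩ : ∃ N : ℕ, R < t N := by
    obtain ⟨N, hN⟩ := exists_nat_gt (2 * R / (δ / 2) + 1)
    refine ⟨N, ?_⟩
    have h1 := (ht N).1
    have h2 : 2 * R / (δ / 2) < N - 1 := by linarith
    rw [div_lt_iff₀ (by positivity)] at h2
    linarith
  have hosc (i : ℕ) (x : ℝ) (hx : x ∈ Set.Ioc (t i) (t (i + 1))) :
      |f x - f (t (i + 1))| ≤ ε := by
    refine (hfδ ?_).le
    have h1 := (ht i).1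
    have h2 := (ht (i + 1)).2
    push_cast at h2
    rw [Real.dist_eq, abs_sub_lt_iff]
    constructor <;> linarith [hx.1, hx.2]
  have hint (ν : Measure ℝ) : ∫ x, f x ∂ν = ∫ x in t 0..t N, f x ∂ν := by
    refine (intervalIntegral.integral_eq_integral_of_support_subset fun x hx => ?_).symm
    have h1 := hR (subset_tsupport f hx)
    have h2 := (ht 0).2
    rw [Real.closedBall_eq_Icc] at h1
    simp only [Nat.cast_zero, zero_mul, add_zero] at h2
    exact ⟨by linarith [h1.1], by linarith [h1.2]⟩
  have hlim (i : ℕ) := hF (t i) (ht0 i)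
  have hmass : FcPos μ α (t N) - FcPos μ α (t 0) ≤ C := by
    rw [FcPos_sub_FcPos, intervalIntegral.integral_of_le (hmono N.zero_le), hC]
    simpa using measureReal_mono (μ := μ) (Set.subset_univ (Set.Ioc (t 0) (t N)))
  have hmass_lim : ∀ᶠ n in atTop, FcPos (μs n) α (t N) - FcPos (μs n) α (t 0) < C + 1 :=
    ((hlim N).sub (hlim 0)).eventually_lt_const (by linarith)
  have hsum_lim := tendsto_finsetSum (Finset.range N) fun i _ =>
    ((hlim (i + 1)).sub (hlim i)).const_mul (f (t (i + 1)))
  filter_upwards [hmass_lim, Metric.tendsto_nhds.1 hsum_lim ε hε] with n hn hSn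
  have h1 := abs_integral_sub_stieltjesSum_le (μs n) α hf hmono N hosc
  have h2 := abs_integral_sub_stieltjesSum_le μ α hf hmono N hosc
  have h3 := mul_le_mul_of_nonneg_left hn.le hε.le
  have h4 := mul_le_mul_of_nonneg_left hmass hε.le
  rw [hint, hint, Real.dist_eq]
  rw [Real.dist_eq] at hSn
  rw [abs_lt] at hSn ⊢
  rw [abs_le] at h1 h2
  constructor <;> linarith [h1.1, h1.2, h2.1, h2.2, hSn.1, hSn.2]
end

section
/- Let {μₙ} and μ be finite positive Borel measures on ℝ and let α ∈ ℝ be a continuity point of μ (i.e. μ({α}) = 0). If μₙ → μ vaguely (i.e. ∫ f dμₙ → ∫ f dμ for every continuous f: ℝ → ℝ with compact support), then the distribution functions centred at α satisfy F_{μₙ}^{(α)}(x) → F_{μ}^{(α)}(x) at every continuity point x of μ. -/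
open MeasureTheory Filter Topology
open scoped ENNReal

theorem integrable_of_continuous_of_mem_Icc {X : Type*} [TopologicalSpace X]
    [MeasurableSpace X] [OpensMeasurableSpace X] {ν : Measure X} [IsFiniteMeasure ν]
    {f : X → ℝ} (hf : Continuous f) (h : ∀ x, f x ∈ Set.Icc (0 : ℝ) 1) : Integrable f ν :=
  .of_bound (C := 1) hf.measurable.aestronglyMeasurable <| .of_forall fun x => by
    rw [Real.norm_of_nonneg (h x).1]
    exact (h x).2

theorem measureReal_le_integral_of_eqOn_one {X : Type*} [TopologicalSpace X]
    [MeasurableSpace X] [OpensMeasurableSpace X] {ν : Measure X} [IsFiniteMeasure ν]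
    {f : X → ℝ} (hf : Continuous f) (h : ∀ x, f x ∈ Set.Icc (0 : ℝ) 1)
    {s : Set X} (hs : MeasurableSet s) (h1 : Set.EqOn f 1 s) : ν.real s ≤ ∫ x, f x ∂ν := by
  rw [← integral_indicator_one hs]
  refine integral_mono ((integrable_const (1 : ℝ)).indicator hs)
    (integrable_of_continuous_of_mem_Icc hf h) fun x => ?_
  by_cases hx : x ∈ s
  · simp [hx, h1 hx]
  · simpa [hx] using (h x).1

theorem integral_le_measureReal_of_eqOn_zero_compl {X : Type*} [TopologicalSpace X]
    [MeasurableSpace X] [OpensMeasurableSpace X] {ν : Measure X} [IsFiniteMeasure ν]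
    {f : X → ℝ} (hf : Continuous f) (h : ∀ x, f x ∈ Set.Icc (0 : ℝ) 1)
    {s : Set X} (hs : MeasurableSet s) (h0 : Set.EqOn f 0 sᶜ) : ∫ x, f x ∂ν ≤ ν.real s := by
  rw [← integral_indicator_one hs]
  refine integral_mono (integrable_of_continuous_of_mem_Icc hf h)
    ((integrable_const (1 : ℝ)).indicator hs) fun x => ?_
  by_cases hx : x ∈ s
  · simpa [hx] using (h x).2
  · simp [hx, h0 (show x ∈ sᶜ from hx)]

theorem VagueTendstoPos.eventually_lt_measureReal_of_isOpen {μs : ℕ → Measure ℝ} {μ : Measure ℝ}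
    [∀ n, IsFiniteMeasure (μs n)] [IsFiniteMeasure μ] (h : VagueTendstoPos μs μ)
    {U : Set ℝ} (hU : IsOpen U) {c : ℝ} (hc : c < μ.real U) :
    ∀ᶠ n in atTop, c < (μs n).real U := by
  obtain hc0 | hc0 := lt_or_ge c 0
  · exact .of_forall fun n => hc0.trans_le measureReal_nonneg
  obtain ⟨K, hKU, hK, hcK⟩ := hU.exists_lt_isCompact
    ((ENNReal.ofReal_lt_iff_lt_toReal hc0 (measure_ne_top μ U)).2 hc)
  obtain ⟨f, h1, h0, hsupp, hf⟩ := exists_continuous_one_zero_of_isCompact hK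
    hU.isClosed_compl (Set.disjoint_compl_right_iff_subset.2 hKU)
  have hlt : c < ∫ x, f x ∂μ :=
    ((ENNReal.ofReal_lt_iff_lt_toReal hc0 (measure_ne_top μ K)).1 hcK).trans_le
      (measureReal_le_integral_of_eqOn_one f.continuous hf hK.measurableSet h1)
  filter_upwards [(h f f.continuous hsupp).eventually (lt_mem_nhds hlt)] with n hn
  exact hn.trans_le
    (integral_le_measureReal_of_eqOn_zero_compl f.continuous hf hU.measurableSet h0)

theorem VagueTendstoPos.eventually_measureReal_lt_of_isCompact {μs : ℕ → Measure ℝ}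
    {μ : Measure ℝ} [∀ n, IsFiniteMeasure (μs n)] [IsFiniteMeasure μ] (h : VagueTendstoPos μs μ)
    {K : Set ℝ} (hK : IsCompact K) {c : ℝ} (hc : μ.real K < c) :
    ∀ᶠ n in atTop, (μs n).real K < c := by
  obtain ⟨U, hKU, hU, hUc⟩ := K.exists_isOpen_lt_of_lt (μ := μ) _
    ((ENNReal.lt_ofReal_iff_toReal_lt (measure_ne_top μ K)).2 hc)
  obtain ⟨f, h1, h0, hsupp, hf⟩ := exists_continuous_one_zero_of_isCompact hK
    hU.isClosed_compl (Set.disjoint_compl_right_iff_subset.2 hKU)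
  have hlt : ∫ x, f x ∂μ < c :=
    (integral_le_measureReal_of_eqOn_zero_compl f.continuous hf hU.measurableSet h0).trans_lt
      ((ENNReal.lt_ofReal_iff_toReal_lt (measure_ne_top μ U)).1 hUc)
  filter_upwards [(h f f.continuous hsupp).eventually (gt_mem_nhds hlt)] with n hn
  exact (measureReal_le_integral_of_eqOn_one f.continuous hf hK.measurableSet h1).trans_lt hn

theorem VagueTendstoPos.tendsto_measureReal_Ioc {μs : ℕ → Measure ℝ} {μ : Measure ℝ}
    [∀ n, IsFiniteMeasure (μs n)] [IsFiniteMeasure μ] (h : VagueTendstoPos μs μ)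
    {a b : ℝ} (ha : μ {a} = 0) (hb : μ {b} = 0) :
    Tendsto (fun n => (μs n).real (Set.Ioc a b)) atTop (𝓝 (μ.real (Set.Ioc a b))) := by
  refine tendsto_order.2 ⟨fun c hc => ?_, fun c hc => ?_⟩
  · rw [← measureReal_congr (Ioo_ae_eq_Ioc' hb)] at hc
    filter_upwards [h.eventually_lt_measureReal_of_isOpen isOpen_Ioo hc] with n hn
    exact hn.trans_le (measureReal_mono Set.Ioo_subset_Ioc_self)
  · rw [measureReal_congr (Ioc_ae_eq_Icc' ha)] at hc
    filter_upwards [h.eventually_measureReal_lt_of_isCompact isCompact_Icc hc] with n hn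
    exact (measureReal_mono Set.Ioc_subset_Icc_self).trans_lt hn

theorem stmt10 (μs : ℕ → Measure ℝ) (μ : Measure ℝ)
    [∀ n, IsFiniteMeasure (μs n)] [IsFiniteMeasure μ]
    (α : ℝ) (hα : μ {α} = 0)
    (hvague : VagueTendstoPos μs μ) :
    ∀ x : ℝ, μ {x} = 0 →
      Tendsto (fun n => FcPos (μs n) α x) atTop (𝓝 (FcPos μ α x)) := by
  intro x hx
  unfold FcPos
  split_ifs
  · exact hvague.tendsto_measureReal_Ioc hα hx
  · exact (hvague.tendsto_measureReal_Ioc hx hα).neg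
end

section
/- Let {μₙ} and μ be finite positive Borel measures on ℝ. Suppose that lim_{K→−∞} [limsup_{n→∞} μₙ((−∞, K])] = 0. Then μₙ → μ vaguely if and only if F_{μₙ}(x) := μₙ((−∞, x]) converges to F_μ(x) := μ((−∞, x]) at every continuity point x of μ. -/
open MeasureTheory Filter Topology
open scoped ENNReal

namespace MeasureTheory

open Set

/-- Up to a factor, the average of `f` over the interval `[x, x + δ)`. -/
noncomputable def windowIntegral (δ : ℝ) (f : ℝ → ℝ) (x : ℝ) : ℝ :=
  ∫ t in Ico x (x + δ), f t

lemma indicator_Ico_eq_indicator_Ioc (f : ℝ → ℝ) (δ x t : ℝ) :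
    (Ico x (x + δ)).indicator f t = (Ioc (t - δ) t).indicator (fun _ => f t) x := by
  by_cases h : t ∈ Ico x (x + δ)
  · have h' : x ∈ Ioc (t - δ) t := ⟨by linarith [h.2], h.1⟩
    rw [indicator_of_mem h, indicator_of_mem h']
  · have h' : x ∉ Ioc (t - δ) t := fun h' => h ⟨h'.2, by linarith [h'.1]⟩
    rw [indicator_of_notMem h, indicator_of_notMem h']

lemma integrable_prod_indicator_Ico (ν : Measure ℝ) [IsFiniteMeasure ν] {f : ℝ → ℝ}
    (hf : Integrable f) (δ : ℝ) :
    Integrable (fun p : ℝ × ℝ => (Ico p.1 (p.1 + δ)).indicator f p.2) (ν.prod volume) := by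
  have hs : MeasurableSet {p : ℝ × ℝ | p.1 ≤ p.2 ∧ p.2 < p.1 + δ} :=
    (measurableSet_le measurable_fst measurable_snd).inter
      (measurableSet_lt measurable_snd (measurable_fst.add_const δ))
  exact (hf.comp_snd ν).indicator hs

lemma integrable_windowIntegral (ν : Measure ℝ) [IsFiniteMeasure ν] {f : ℝ → ℝ}
    (hf : Integrable f) (δ : ℝ) : Integrable (windowIntegral δ f) ν := by
  have h := (integrable_prod_indicator_Ico ν hf δ).integral_prod_left
  simp only [integral_indicator measurableSet_Ico] at h
  exact h

lemma integral_windowIntegral (ν : Measure ℝ) [IsFiniteMeasure ν] {f : ℝ → ℝ}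
    (hf : Integrable f) {δ : ℝ} (hδ : 0 ≤ δ) :
    ∫ x, windowIntegral δ f x ∂ν = ∫ t, (ν.real (Iic t) - ν.real (Iic (t - δ))) * f t := by
  calc ∫ x, windowIntegral δ f x ∂ν
      = ∫ x, (∫ t, (Ico x (x + δ)).indicator f t) ∂ν := by
        simp only [windowIntegral, integral_indicator measurableSet_Ico]
    _ = ∫ t, (∫ x, (Ico x (x + δ)).indicator f t ∂ν) :=
        integral_integral_swap (integrable_prod_indicator_Ico ν hf δ)
    _ = _ := by
        congr 1 with t
        simp only [indicator_Ico_eq_indicator_Ioc]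
        rw [integral_indicator measurableSet_Ioc, setIntegral_const, smul_eq_mul,
          ← Iic_sdiff_Iic, measureReal_sdiff (Iic_subset_Iic.2 (by linarith)) measurableSet_Iic]

lemma abs_windowIntegral_sub_le {f : ℝ → ℝ} (hf : Integrable f) {δ η : ℝ} (hδ : 0 ≤ δ)
    (h : ∀ x y, |x - y| ≤ δ → |f x - f y| ≤ η) (x : ℝ) :
    |windowIntegral δ f x - δ * f x| ≤ δ * η := by
  have hv : volume.real (Ico x (x + δ)) = δ := by simp [hδ]
  have hc : ∫ _ in Ico x (x + δ), f x = δ * f x := by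
    rw [setIntegral_const, hv, smul_eq_mul]
  rw [windowIntegral, ← hc, ← integral_sub hf.integrableOn (integrableOn_const (by simp))]
  have := norm_setIntegral_le_of_norm_le_const (μ := volume) (s := Ico x (x + δ)) (C := η)
    (f := fun t => f t - f x) (by simp)
    (fun t ht => h t x (by rw [abs_le]; constructor <;> linarith [ht.1, ht.2]))
  rwa [hv, mul_comm η] at this

lemma abs_integral_windowIntegral_sub_le (ν : Measure ℝ) [IsFiniteMeasure ν] {f : ℝ → ℝ}
    (hf : Integrable f) (hfν : Integrable f ν) {δ η : ℝ} (hδ : 0 ≤ δ)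
    (h : ∀ x y, |x - y| ≤ δ → |f x - f y| ≤ η) :
    |∫ x, windowIntegral δ f x ∂ν - δ * ∫ x, f x ∂ν| ≤ δ * η * ν.real univ := by
  rw [← integral_const_mul, ← integral_sub (integrable_windowIntegral ν hf δ) (hfν.const_mul δ)]
  exact norm_integral_le_of_norm_le_const (f := fun x => windowIntegral δ f x - δ * f x)
    (ae_of_all _ (abs_windowIntegral_sub_le hf hδ h))

lemma countable_setOf_measure_singleton_ne_zero (μ : Measure ℝ) [IsFiniteMeasure μ] :
    {x | μ {x} ≠ 0}.Countable := by
  have h := Measure.countable_meas_level_set_pos (μ := μ) (g := fun x : ℝ => x) measurable_id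
  refine h.mono fun x hx => ?_
  simpa [pos_iff_ne_zero] using hx

/-- Finite measures of bounded mass whose distribution functions converge at the continuity points
of the limit integrate compactly supported continuous functions to the expected limit. -/
lemma tendsto_integral_of_tendsto_measureReal_Iic {νs : ℕ → Measure ℝ} {ν : Measure ℝ}
    [∀ n, IsFiniteMeasure (νs n)] [IsFiniteMeasure ν] {C : ℝ}
    (hC : ∀ n, (νs n).real univ ≤ C)
    (h : ∀ x, ν {x} = 0 → Tendsto (fun n => (νs n).real (Iic x)) atTop (𝓝 (ν.real (Iic x))))
    {f : ℝ → ℝ} (hf : Continuous f) (hfc : HasCompactSupport f) :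
    Tendsto (fun n => ∫ x, f x ∂(νs n)) atTop (𝓝 (∫ x, f x ∂ν)) := by
  have hfi (m : Measure ℝ) [IsFiniteMeasure m] : Integrable f m :=
    hf.integrable_of_hasCompactSupport hfc
  have hfv : Integrable f := hf.integrable_of_hasCompactSupport hfc
  have hC0 : 0 ≤ C := measureReal_nonneg.trans (hC 0)
  have hcount := countable_setOf_measure_singleton_ne_zero ν
  have hwindow {δ : ℝ} (hδ : 0 ≤ δ) :
      Tendsto (fun n => ∫ x, windowIntegral δ f x ∂(νs n)) atTop
        (𝓝 (∫ x, windowIntegral δ f x ∂ν)) := by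
    simp only [integral_windowIntegral _ hfv hδ]
    refine tendsto_integral_of_dominated_convergence (fun t => C * |f t|) (fun n => ?_)
      (hfv.abs.const_mul C) (fun n => ae_of_all _ fun t => ?_) ?_
    · have hm : Monotone fun t => (νs n).real (Iic t) :=
        fun a b hab => measureReal_mono (Iic_subset_Iic.2 hab)
      exact ((hm.measurable.sub (hm.measurable.comp (measurable_id.sub_const δ))).mul
        hf.measurable).aestronglyMeasurable
    · rw [norm_mul, Real.norm_eq_abs, Real.norm_eq_abs]
      refine mul_le_mul_of_nonneg_right ?_ (abs_nonneg _)
      have h1 : (νs n).real (Iic t) ≤ (νs n).real univ := measureReal_mono (subset_univ _)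
      have h2 : (νs n).real (Iic (t - δ)) ≤ (νs n).real univ := measureReal_mono (subset_univ _)
      have h3 : 0 ≤ (νs n).real (Iic t) := measureReal_nonneg
      have h4 : 0 ≤ (νs n).real (Iic (t - δ)) := measureReal_nonneg
      rw [abs_le]
      constructor <;> linarith [hC n]
    · have hshift : {t | ν {t - δ} ≠ 0}.Countable :=
        hcount.preimage (sub_left_injective (b := δ))
      filter_upwards [hcount.ae_notMem volume, hshift.ae_notMem volume] with t ht ht'
      exact ((h t (not_not.1 ht)).sub (h (t - δ) (not_not.1 ht'))).mul_const _
  set M := C + ν.real univ + 1 with hM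
  have hνM : (0 : ℝ) ≤ ν.real univ := measureReal_nonneg
  have hM0 : 0 < M := by positivity
  rw [Metric.tendsto_atTop]
  intro ε hε
  obtain ⟨r, hr, hrf⟩ := Metric.uniformContinuous_iff.1
    (hfc.uniformContinuous_of_continuous hf) (ε / (2 * M)) (by positivity)
  set δ := r / 2 with hδdef
  have hδ : 0 < δ := by positivity
  have hη : ∀ x y, |x - y| ≤ δ → |f x - f y| ≤ ε / (2 * M) := fun x y hxy =>
    (hrf (a := x) (b := y) (by rw [Real.dist_eq]; linarith)).le
  obtain ⟨N, hN⟩ := Metric.tendsto_atTop.1 (hwindow hδ.le) (δ * (ε / (2 * M)))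
    (by positivity)
  refine ⟨N, fun n hn => ?_⟩
  have h1 := abs_integral_windowIntegral_sub_le (νs n) hfv (hfi _) hδ.le hη
  have h2 := abs_integral_windowIntegral_sub_le ν hfv (hfi _) hδ.le hη
  have h3 := hN n hn
  have h4 : δ * (ε / (2 * M)) * (νs n).real univ ≤ δ * (ε / (2 * M)) * C :=
    mul_le_mul_of_nonneg_left (hC n) (by positivity)
  have h5 : δ * (ε / (2 * M)) * M = δ * (ε / 2) := by field_simp
  have h6 : 0 < δ * ε := by positivity
  have h7 : δ * (ε / (2 * M)) * M = δ * (ε / (2 * M)) * C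
      + δ * (ε / (2 * M)) * ν.real univ + δ * (ε / (2 * M)) := by
    rw [hM]; ring
  rw [Real.dist_eq] at h3 ⊢
  refine lt_of_mul_lt_mul_left ?_ hδ.le
  rw [← abs_of_pos hδ, ← abs_mul, abs_of_pos hδ, mul_sub]
  rw [abs_le] at h1 h2
  rw [abs_lt] at h3 ⊢
  constructor <;> linarith

lemma exists_forall_integral_le_and_le_integral (K : ℝ) {u v : ℝ} (huv : u < v) :
    ∃ f : ℝ → ℝ, Continuous f ∧ HasCompactSupport f ∧
      ∀ (m : Measure ℝ) [IsFiniteMeasure m], ∫ x, f x ∂m ≤ m.real (Iic v) ∧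
        m.real (Iic u) ≤ m.real (Iic K) + ∫ x, f x ∂m := by
  obtain ⟨f, hf1, hf0, hfc, hf⟩ := exists_continuous_one_zero_of_isCompact
    (isCompact_Icc (a := K) (b := u)) (isClosed_Ici (a := v))
    (disjoint_left.2 fun x hx hx' => absurd (hx.2.trans_lt huv) (not_lt.2 hx'))
  refine ⟨f, f.continuous, hfc, fun m _ => ?_⟩
  have hfm : Integrable f m := f.continuous.integrable_of_hasCompactSupport hfc
  constructor
  · rw [← integral_indicator_one measurableSet_Iic]
    refine integral_mono hfm ((integrable_const 1).indicator measurableSet_Iic) fun x => ?_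
    by_cases hx : x ∈ Iic v
    · simpa [indicator_of_mem hx] using (hf x).2
    · have : f x = 0 := hf0 (mem_Ici.2 (not_le.1 hx).le)
      simp [indicator_of_notMem hx, this]
  · have hsub : Iic u ⊆ Iic K ∪ Icc K u := fun x hx =>
      (le_total x K).imp id fun h => ⟨h, hx⟩
    have hle : m.real (Icc K u) ≤ ∫ x, f x ∂m := by
      rw [← integral_indicator_one measurableSet_Icc]
      refine integral_mono ((integrable_const 1).indicator measurableSet_Icc) hfm fun x => ?_
      by_cases hx : x ∈ Icc K u
      · have : f x = 1 := hf1 hx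
        simp [indicator_of_mem hx, this]
      · simpa [indicator_of_notMem hx] using (hf x).1
    linarith [measureReal_mono (μ := m) hsub, measureReal_union_le (μ := m) (Iic K) (Icc K u)]

lemma exists_lt_lt_measureReal_Iic_lt_add (μ : Measure ℝ) [IsFiniteMeasure μ] {x ε : ℝ}
    (hx : μ {x} = 0) (hε : 0 < ε) :
    ∃ u v, u < x ∧ x < v ∧ μ.real (Iic v) < μ.real (Iic u) + ε := by
  obtain ⟨U, hxU, hU, hμU⟩ := ({x} : Set ℝ).exists_isOpen_lt_of_lt (μ := μ) (ENNReal.ofReal ε)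
    (by rw [hx]; exact ENNReal.ofReal_pos.2 hε)
  obtain ⟨r, hr, hrU⟩ := Metric.isOpen_iff.1 hU x (hxU rfl)
  refine ⟨x - r / 2, x + r / 2, by linarith, by linarith, ?_⟩
  have hsub : Iic (x + r / 2) ⊆ Iic (x - r / 2) ∪ U := by
    intro y hy
    refine (le_or_gt y (x - r / 2)).imp id fun h => hrU ?_
    rw [Metric.mem_ball, Real.dist_eq, abs_lt]
    have hy' : y ≤ x + r / 2 := hy
    constructor <;> linarith
  have hUε : μ.real U < ε := (ENNReal.lt_ofReal_iff_toReal_lt (by finiteness)).1 hμU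
  linarith [measureReal_mono (μ := μ) hsub, measureReal_union_le (μ := μ) (Iic (x - r / 2)) U]

lemma exists_eventually_measureReal_Iic_lt {μs : ℕ → Measure ℝ} {μ : Measure ℝ}
    [∀ n, IsFiniteMeasure (μs n)] [IsFiniteMeasure μ]
    (hmass : Tendsto (fun K : ℝ => limsup (fun n => μs n (Iic K)) atTop) atBot (𝓝 (0 : ℝ≥0∞)))
    {ε : ℝ} (hε : 0 < ε) :
    ∃ K, μ.real (Iic K) < ε ∧ ∀ᶠ n in atTop, (μs n).real (Iic K) < ε := by
  have hε' : 0 < ENNReal.ofReal ε := ENNReal.ofReal_pos.2 hε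
  have hμ : Tendsto (fun K => μ (Iic K)) atBot (𝓝 0) := by
    have h := tendsto_measure_iInter_atBot (μ := μ) (s := fun K : ℝ => Iic K)
      (fun K => measurableSet_Iic.nullMeasurableSet) (fun _ _ => Iic_subset_Iic.2)
      ⟨0, measure_ne_top μ _⟩
    rwa [iInter_Iic_eq_empty_iff.2 (by simp [range_id', not_bddBelow_univ]), measure_empty] at h
  obtain ⟨K, hK, hKμ⟩ := ((hmass.eventually_lt_const hε').and
    (hμ.eventually_lt_const hε')).exists
  refine ⟨K, (ENNReal.lt_ofReal_iff_toReal_lt (by finiteness)).1 hKμ, ?_⟩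
  filter_upwards [eventually_lt_of_limsup_lt hK] with n hn
  exact (ENNReal.lt_ofReal_iff_toReal_lt (by finiteness)).1 hn

/-- Vague convergence without loss of mass at `-∞` implies convergence of the distribution
functions at continuity points of the limit. -/
lemma tendsto_measureReal_Iic_of_vagueTendstoPos {μs : ℕ → Measure ℝ} {μ : Measure ℝ}
    [∀ n, IsFiniteMeasure (μs n)] [IsFiniteMeasure μ]
    (hmass : Tendsto (fun K : ℝ => limsup (fun n => μs n (Iic K)) atTop) atBot (𝓝 (0 : ℝ≥0∞)))
    (h : VagueTendstoPos μs μ) {x : ℝ} (hx : μ {x} = 0) :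
    Tendsto (fun n => (μs n).real (Iic x)) atTop (𝓝 (μ.real (Iic x))) := by
  rw [Metric.tendsto_nhds]
  intro ε hε
  obtain ⟨K, hKμ, hK⟩ := exists_eventually_measureReal_Iic_lt (μ := μ) hmass
    (show 0 < ε / 3 by positivity)
  obtain ⟨u, v, hux, hxv, huv⟩ := exists_lt_lt_measureReal_Iic_lt_add μ hx
    (show 0 < ε / 3 by positivity)
  obtain ⟨f, hf, hfc, hfm⟩ := exists_forall_integral_le_and_le_integral K hux
  obtain ⟨g, hg, hgc, hgm⟩ := exists_forall_integral_le_and_le_integral K hxv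
  filter_upwards [hK, Metric.tendsto_nhds.1 (h f hf hfc) (ε / 3) (by positivity),
    Metric.tendsto_nhds.1 (h g hg hgc) (ε / 3) (by positivity)] with n hn hfn hgn
  have hu : μ.real (Iic u) ≤ μ.real (Iic x) := measureReal_mono (Iic_subset_Iic.2 hux.le)
  have hv : μ.real (Iic x) ≤ μ.real (Iic v) := measureReal_mono (Iic_subset_Iic.2 hxv.le)
  rw [Real.dist_eq, abs_lt] at hfn hgn ⊢
  constructor <;> linarith [(hfm μ).2, (hfm (μs n)).1, (hgm μ).1, (hgm (μs n)).2]

/-- Convergence of the distribution functions at continuity points of the limit implies vague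
convergence. -/
lemma vagueTendstoPos_of_tendsto_measureReal_Iic {μs : ℕ → Measure ℝ} {μ : Measure ℝ}
    [∀ n, IsFiniteMeasure (μs n)] [IsFiniteMeasure μ]
    (h : ∀ x, μ {x} = 0 → Tendsto (fun n => (μs n).real (Iic x)) atTop (𝓝 (μ.real (Iic x)))) :
    VagueTendstoPos μs μ := by
  intro f hf hfc
  obtain ⟨B₀, hB₀⟩ := hfc.isCompact.bddAbove
  obtain ⟨B, hB, hB₀B, -⟩ := ((countable_setOf_measure_singleton_ne_zero μ).dense_compl
    ℝ).exists_between (lt_add_one B₀)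
  have hBμ : μ {B} = 0 := not_not.1 hB
  have hrestrict (m : Measure ℝ) : ∫ x, f x ∂(m.restrict (Iic B)) = ∫ x, f x ∂m :=
    setIntegral_eq_integral_of_forall_compl_eq_zero fun x hx =>
      image_eq_zero_of_notMem_tsupport fun hx' => hx ((hB₀ hx').trans hB₀B.le)
  obtain ⟨C, hC⟩ := (h B hBμ).bddAbove_range
  have hreal (m : Measure ℝ) (x : ℝ) :
      (m.restrict (Iic B)).real (Iic x) = m.real (Iic (min x B)) := by
    rw [measureReal_restrict_apply measurableSet_Iic, Iic_inter_Iic]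
  have key := tendsto_integral_of_tendsto_measureReal_Iic
    (νs := fun n => (μs n).restrict (Iic B)) (ν := μ.restrict (Iic B)) (C := C)
    (fun n => by simpa using hC (mem_range_self n)) (fun x hx => ?_) hf hfc
  · simpa only [hrestrict] using key
  · simp only [hreal]
    apply h
    rcases le_total x B with hxB | hxB
    · rw [min_eq_left hxB]
      rwa [Measure.restrict_apply (measurableSet_singleton x),
        inter_eq_self_of_subset_left (singleton_subset_iff.2 (mem_Iic.2 hxB))] at hx
    · rwa [min_eq_right hxB]

end MeasureTheory

theorem stmt11 (μs : ℕ → Measure ℝ) (μ : Measure ℝ)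
    [∀ n, IsFiniteMeasure (μs n)] [IsFiniteMeasure μ]
    (hmass : Tendsto (fun K : ℝ => limsup (fun n => μs n (Set.Iic K)) atTop)
      atBot (𝓝 (0 : ℝ≥0∞))) :
    VagueTendstoPos μs μ ↔
      ∀ x : ℝ, μ {x} = 0 →
        Tendsto (fun n => (μs n (Set.Iic x)).toReal) atTop
          (𝓝 ((μ (Set.Iic x)).toReal)) :=
  ⟨fun h _ hx => tendsto_measureReal_Iic_of_vagueTendstoPos hmass h hx,
    vagueTendstoPos_of_tendsto_measureReal_Iic⟩
end

section
/- Let α ∈ ℝ and let {μₙ} and μ be finite signed Borel measures on ℝ. If the distribution functions centred at α satisfy F_{μₙ}^{(α)}(x) → F_{μ}^{(α)}(x) at every continuity point x of μ, and the sequence {μₙ} is bounded on compact sets (i.e. sup_n |μₙ|(K) < ∞ for every compact K ⊆ ℝ), then μₙ → μ vaguely (i.e. ∫ f dμₙ → ∫ f dμ for every continuous f: ℝ → ℝ with compact support). -/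
open MeasureTheory Filter Topology
open scoped ENNReal

/-- The set of atoms of a finite signed measure is countable. -/
theorem countable_atoms (μ : SignedMeasure ℝ) : {x : ℝ | μ {x} ≠ 0}.Countable := by
  have h (ν : Measure ℝ) [IsFiniteMeasure ν] : {x : ℝ | 0 < ν {x}}.Countable :=
    Measure.countable_meas_pos_of_disjoint_iUnion (fun x => measurableSet_singleton x)
      (fun x y hxy => by simpa [Function.onFun] using hxy)
  refine ((h μ.toJordanDecomposition.posPart).union
    (h μ.toJordanDecomposition.negPart)).mono fun x hx => ?_
  by_contra hcon
  simp only [Set.mem_union, Set.mem_ofPred_eq, not_or, not_lt, nonpos_iff_eq_zero] at hcon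
  apply hx
  rw [SignedMeasure.apply_eq_posPart_real_sub_negPart_real _ (measurableSet_singleton x)]
  simp [Measure.real, hcon.1, hcon.2]

/-- The continuity points of a finite signed measure are dense. -/
theorem dense_continuityPoints (μ : SignedMeasure ℝ) : Dense {x : ℝ | μ {x} = 0} := by
  simpa [Set.compl_ofPred] using (countable_atoms μ).dense_compl ℝ

theorem signedMeasure_Ioc_add (ν : SignedMeasure ℝ) {a b c : ℝ} (hab : a ≤ b) (hbc : b ≤ c) :
    ν (Set.Ioc a c) = ν (Set.Ioc a b) + ν (Set.Ioc b c) := by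
  rw [← Set.Ioc_union_Ioc_eq_Ioc hab hbc]
  exact VectorMeasure.of_union (Set.Ioc_disjoint_Ioc_of_le le_rfl) measurableSet_Ioc
    measurableSet_Ioc

theorem Fc_sub_Fc (ν : SignedMeasure ℝ) (α : ℝ) {a b : ℝ} (hab : a ≤ b) :
    Fc ν α b - Fc ν α a = ν (Set.Ioc a b) := by
  unfold Fc
  split_ifs with hb ha ha
  · linarith [signedMeasure_Ioc_add ν ha hab]
  · linarith [signedMeasure_Ioc_add ν (le_of_not_ge ha) hb]
  · exact absurd (ha.trans hab) hb
  · linarith [signedMeasure_Ioc_add ν hab (le_of_not_ge hb)]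

theorem sum_indicator_Ioc (p : ℕ → ℝ) (hp : Monotone p) (f : ℝ → ℝ) (x : ℝ) (N : ℕ) :
    ∑ k ∈ Finset.range N, (Set.Ioc (p k) (p (k + 1))).indicator f x =
      (Set.Ioc (p 0) (p N)).indicator f x := by
  induction N with
  | zero => simp
  | succ n ih =>
    rw [Finset.sum_range_succ, ih, ← Set.Ioc_union_Ioc_eq_Ioc (hp n.zero_le) (hp n.le_succ),
      Set.indicator_union_of_disjoint (Set.Ioc_disjoint_Ioc_of_le le_rfl)]

/-- The left-endpoint step function of `f` along the first `N` cells of a partition `p`. -/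
noncomputable def stepFn (p : ℕ → ℝ) (N : ℕ) (f : ℝ → ℝ) (x : ℝ) : ℝ :=
  ∑ k ∈ Finset.range N, (Set.Ioc (p k) (p (k + 1))).indicator (fun _ => f (p k)) x

theorem integrable_stepFn (p : ℕ → ℝ) (N : ℕ) (f : ℝ → ℝ) (ν : Measure ℝ) [IsFiniteMeasure ν] :
    Integrable (stepFn p N f) ν :=
  integrable_finsetSum _ fun _ _ => (integrable_const _).indicator measurableSet_Ioc

theorem sInt_stepFn (p : ℕ → ℝ) (N : ℕ) (f : ℝ → ℝ) (ν : SignedMeasure ℝ) :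
    sInt ν (stepFn p N f) = ∑ k ∈ Finset.range N, f (p k) * ν (Set.Ioc (p k) (p (k + 1))) := by
  have h (m : Measure ℝ) [IsFiniteMeasure m] : ∫ x, stepFn p N f x ∂m =
      ∑ k ∈ Finset.range N, f (p k) * m.real (Set.Ioc (p k) (p (k + 1))) := by
    unfold stepFn
    rw [integral_finsetSum _ fun _ _ => (integrable_const _).indicator measurableSet_Ioc]
    refine Finset.sum_congr rfl fun k _ => ?_
    rw [integral_indicator_const _ measurableSet_Ioc, smul_eq_mul, mul_comm]
  unfold sInt
  rw [h, h, ← Finset.sum_sub_distrib]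
  refine Finset.sum_congr rfl fun k _ => ?_
  rw [SignedMeasure.apply_eq_posPart_real_sub_negPart_real _ measurableSet_Ioc, mul_sub]

theorem tendsto_sInt_stepFn {α : ℝ} {μs : ℕ → SignedMeasure ℝ} {μ : SignedMeasure ℝ}
    (hF : ∀ x : ℝ, μ {x} = (0 : ℝ) → Tendsto (fun n => Fc (μs n) α x) atTop (𝓝 (Fc μ α x)))
    (p : ℕ → ℝ) (hp : Monotone p) (hpμ : ∀ k, μ {p k} = 0) (N : ℕ) (f : ℝ → ℝ) :
    Tendsto (fun n => sInt (μs n) (stepFn p N f)) atTop (𝓝 (sInt μ (stepFn p N f))) := by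
  simp only [sInt_stepFn]
  refine tendsto_finsetSum _ fun k _ => Tendsto.const_mul _ ?_
  simp only [← Fc_sub_Fc _ α (hp k.le_succ)]
  exact (hF _ (hpμ _)).sub (hF _ (hpμ _))

/-- A uniform bound on a function supported in `K` bounds its integral by the variation of `K`. -/
theorem abs_sInt_sub_sInt_le (ν : SignedMeasure ℝ) {f g : ℝ → ℝ} {K : Set ℝ} {ε : ℝ}
    (hK : MeasurableSet K) (hf : ∀ (m : Measure ℝ) [IsFiniteMeasure m], Integrable f m)
    (hg : ∀ (m : Measure ℝ) [IsFiniteMeasure m], Integrable g m)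
    (hfg : ∀ x, |f x - g x| ≤ K.indicator (fun _ => ε) x) :
    |sInt ν f - sInt ν g| ≤ ε * (ν.totalVariation K).toReal := by
  have h (m : Measure ℝ) [IsFiniteMeasure m] :
      |∫ x, f x ∂m - ∫ x, g x ∂m| ≤ ε * (m K).toReal := by
    rw [← integral_sub (hf m) (hg m)]
    refine (norm_integral_le_of_norm_le (f := fun x => f x - g x) ((integrable_const ε).indicator hK)
      (Eventually.of_forall hfg)).trans_eq ?_
    rw [integral_indicator_const _ hK, smul_eq_mul, mul_comm, Measure.real]
  have h₁ := abs_le.1 (h ν.toJordanDecomposition.posPart)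
  have h₂ := abs_le.1 (h ν.toJordanDecomposition.negPart)
  rw [SignedMeasure.totalVariation, Measure.add_apply,
    ENNReal.toReal_add (measure_ne_top _ _) (measure_ne_top _ _)]
  unfold sInt
  rw [abs_le]
  constructor <;> linarith [h₁.1, h₁.2, h₂.1, h₂.2]

theorem abs_sub_stepFn_le {f : ℝ → ℝ} {p : ℕ → ℝ} (hp : Monotone p) {N : ℕ} {δ ε : ℝ}
    (hfδ : ∀ x y, |x - y| < δ → |f x - f y| ≤ ε) (hpδ : ∀ k, p (k + 1) - p k < δ)
    (hsupp : ∀ x ∉ Set.Ioc (p 0) (p N), f x = 0) (x : ℝ) :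
    |f x - stepFn p N f x| ≤ (Set.Ioc (p 0) (p N)).indicator (fun _ => ε) x := by
  have hfx : f x = (Set.Ioc (p 0) (p N)).indicator f x := by
    by_cases hx : x ∈ Set.Ioc (p 0) (p N)
    · rw [Set.indicator_of_mem hx]
    · rw [Set.indicator_of_notMem hx, hsupp x hx]
  rw [hfx, ← sum_indicator_Ioc p hp, ← sum_indicator_Ioc p hp, stepFn, ← Finset.sum_sub_distrib]
  refine (Finset.abs_sum_le_sum_abs _ _).trans (Finset.sum_le_sum fun k _ => ?_)
  by_cases hx : x ∈ Set.Ioc (p k) (p (k + 1))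
  · simp only [Set.indicator_of_mem hx]
    apply hfδ
    rw [abs_of_pos (sub_pos.2 hx.1)]
    linarith [hx.2, hpδ k]
  · simp [Set.indicator_of_notMem hx]

/-- Any bounded interval is covered by a partition of mesh less than `δ` with division points in
a given dense set, staying within distance one of the interval. -/
theorem exists_fine_partition {D : Set ℝ} (hD : Dense D) (R : ℕ) {δ : ℝ} (hδ : 0 < δ) :
    ∃ (p : ℕ → ℝ) (N : ℕ), Monotone p ∧ (∀ k, p k ∈ D) ∧ (∀ k, p (k + 1) - p k < δ) ∧
      p 0 ∈ Set.Ioo (-R - 1 : ℝ) (-R) ∧ p N ∈ Set.Ioo (R : ℝ) (R + 1) := by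
  obtain ⟨m, hm⟩ := exists_nat_one_div_lt (half_pos hδ)
  set η : ℝ := 1 / ((m : ℝ) + 1) with hη
  have hη0 : 0 < η := by positivity
  have hη1 : η ≤ 1 := by
    rw [hη, div_le_one (by positivity)]
    linarith [Nat.cast_nonneg (α := ℝ) m]
  have hmη : ((m : ℝ) + 1) * η = 1 := by rw [hη]; field_simp
  choose p hpD hp using fun k : ℕ =>
    hD.exists_between (show -(R : ℝ) + (k - 1) * η < -R + k * η by nlinarith)
  refine ⟨p, 2 * R * (m + 1) + 1, monotone_nat_of_le_succ fun k => ?_, hpD, fun k => ?_, ?_, ?_⟩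
  · have h := (hp (k + 1)).1
    push_cast at h
    rw [add_sub_cancel_right] at h
    exact ((hp k).2.trans h).le
  · have h := (hp (k + 1)).2
    push_cast at h
    nlinarith [(hp k).1]
  · have h := hp 0
    simp only [Set.mem_Ioo, Nat.cast_zero] at h ⊢
    constructor <;> linarith [h.1, h.2]
  · have h := hp (2 * R * (m + 1) + 1)
    have hN : (2 * (R : ℝ) * (m + 1)) * η = 2 * R := by rw [mul_assoc, hmη, mul_one]
    push_cast at h
    rw [add_sub_cancel_right, add_mul, hN] at h
    constructor <;> linarith [h.1, h.2]

theorem exists_nat_support_subset_Icc {f : ℝ → ℝ} (hf : HasCompactSupport f) :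
    ∃ R : ℕ, ∀ x, f x ≠ 0 → |x| ≤ R := by
  obtain ⟨r, hr⟩ := hf.isCompact.isBounded.exists_norm_le
  obtain ⟨R, hR⟩ := exists_nat_ge r
  exact ⟨R, fun x hx => (hr x (subset_tsupport f hx)).trans hR⟩

theorem stmt12 (α : ℝ) (μs : ℕ → SignedMeasure ℝ) (μ : SignedMeasure ℝ)
    (hF : ∀ x : ℝ, μ {x} = (0 : ℝ) →
      Tendsto (fun n => Fc (μs n) α x) atTop (𝓝 (Fc μ α x)))
    (hbdd : ∀ K : Set ℝ, IsCompact K → (⨆ n, (μs n).totalVariation K) < ⊤) :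
    VagueTendsto μs μ := by
  intro f hfc hfs
  obtain ⟨R, hR⟩ := exists_nat_support_subset_Icc hfs
  set K : Set ℝ := Set.Icc (-R - 1) (R + 1)
  set B : ℝ := (⨆ n, (μs n).totalVariation K).toReal
  set M : ℝ := (μ.totalVariation K).toReal
  have hB (n : ℕ) : ((μs n).totalVariation K).toReal ≤ B :=
    ENNReal.toReal_mono (hbdd K isCompact_Icc).ne
      (le_iSup (fun n => (μs n).totalVariation K) n)
  have hB0 : 0 ≤ B := ENNReal.toReal_nonneg
  have hM0 : 0 ≤ M := ENNReal.toReal_nonneg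
  rw [Metric.tendsto_atTop]
  intro ε hε
  set η : ℝ := ε / (2 * (B + M + 1)) with hη
  have hη0 : 0 < η := by positivity
  have hηε : η * (B + M + 1) = ε / 2 := by rw [hη]; field_simp
  obtain ⟨δ, hδ, hfδ⟩ := Metric.uniformContinuous_iff.1
    (hfs.uniformContinuous_of_continuous hfc) η hη0
  obtain ⟨p, N, hp, hpμ, hpδ, hp0, hpN⟩ :=
    exists_fine_partition (dense_continuityPoints μ) R hδ
  have hsupp : ∀ x ∉ Set.Ioc (p 0) (p N), f x = 0 := by
    intro x hx
    by_contra hfx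
    have hxR := abs_le.1 (hR x hfx)
    exact hx ⟨hp0.2.trans_le hxR.1, hxR.2.trans hpN.1.le⟩
  have hsub : Set.Ioc (p 0) (p N) ⊆ K :=
    Set.Ioc_subset_Icc_self.trans (Set.Icc_subset_Icc hp0.1.le hpN.2.le)
  have happrox (x : ℝ) : |f x - stepFn p N f x| ≤ K.indicator (fun _ => η) x :=
    (abs_sub_stepFn_le hp (fun x y hxy => (hfδ hxy).le) hpδ hsupp x).trans
      (Set.indicator_le_indicator_of_subset hsub (fun _ => hη0.le) x)
  have hstep (ν : SignedMeasure ℝ) :=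
    abs_sInt_sub_sInt_le ν measurableSet_Icc
      (fun m _ => hfc.integrable_of_hasCompactSupport hfs)
      (fun m _ => integrable_stepFn p N f m) happrox
  obtain ⟨n₀, hn₀⟩ := Metric.tendsto_atTop.1 (tendsto_sInt_stepFn hF p hp hpμ N f) (ε / 2)
    (half_pos hε)
  refine ⟨n₀, fun n hn => ?_⟩
  have h₁ := abs_le.1 ((hstep (μs n)).trans (mul_le_mul_of_nonneg_left (hB n) hη0.le))
  have h₂ := abs_le.1 (hstep μ)
  have h₃ := hn₀ n hn
  rw [Real.dist_eq, abs_lt] at h₃ ⊢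
  constructor <;> linarith [h₁.1, h₁.2, h₂.1, h₂.2, h₃.1, h₃.2]
end

section
/- Let α ∈ ℝ and let {μₙ} and μ be finite signed Borel measures on ℝ. Suppose μₙ → μ vaguely, α is a continuity point of μ (μ({α}) = 0), and the sequence {μₙ} has no mass at any continuity point of μ (i.e. for every x with μ({x}) = 0 and every ε > 0 there is an open neighbourhood N of x with limsup_{n→∞} |μₙ|(N) ≤ ε). Then F_{μₙ}^{(α)}(x) → F_{μ}^{(α)}(x) at every continuity point x of μ. -/
open MeasureTheory Filter Topology
open scoped ENNReal

theorem totalVariation_singleton_eq_zero {Ω : Type*} [MeasurableSpace Ω]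
    [MeasurableSingletonClass Ω] (ν : SignedMeasure Ω) {x : Ω} (hx : ν {x} = 0) :
    ν.totalVariation {x} = 0 := by
  obtain ⟨s, hs, hpos, hneg⟩ := ν.toJordanDecomposition.mutuallySingular
  have hreal := ν.apply_eq_posPart_real_sub_negPart_real (measurableSet_singleton x)
  rw [hx] at hreal
  have heq : ν.toJordanDecomposition.posPart {x} = ν.toJordanDecomposition.negPart {x} :=
    (measureReal_eq_measureReal_iff).1 (by linarith)
  have hzero : ν.toJordanDecomposition.posPart {x} = 0 := by
    by_cases hxs : x ∈ s
    · exact measure_mono_null (Set.singleton_subset_iff.2 hxs) hpos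
    · rw [heq]
      exact measure_mono_null (Set.singleton_subset_iff.2 hxs) hneg
  simp [SignedMeasure.totalVariation, ← heq, hzero]

theorem abs_integral_sub_measureReal_le {Ω : Type*} [MeasurableSpace Ω] (p : Measure Ω)
    [IsFiniteMeasure p] {f : Ω → ℝ} (hf : Integrable f p) {I U : Set Ω}
    (hI : MeasurableSet I) (hU : MeasurableSet U)
    (hfU : ∀ y, |f y - I.indicator 1 y| ≤ U.indicator 1 y) :
    |(∫ y, f y ∂p) - p.real I| ≤ p.real U := by
  have hIi : Integrable (I.indicator (1 : Ω → ℝ)) p := (integrable_const 1).indicator hI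
  have hUi : Integrable (U.indicator (1 : Ω → ℝ)) p := (integrable_const 1).indicator hU
  rw [← integral_indicator_one hI, ← integral_indicator_one hU, ← integral_sub hf hIi]
  rw [← Real.norm_eq_abs]
  refine norm_integral_le_of_norm_le hUi (ae_of_all _ fun y ↦ ?_)
  exact hfU y

theorem abs_sInt_sub_apply_le {Ω : Type*} [MeasurableSpace Ω] (ν : SignedMeasure Ω)
    {f : Ω → ℝ} (hf : ∀ p : Measure Ω, IsFiniteMeasure p → Integrable f p) {I U : Set Ω}
    (hI : MeasurableSet I) (hU : MeasurableSet U)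
    (hfU : ∀ y, |f y - I.indicator 1 y| ≤ U.indicator 1 y) :
    |sInt ν f - ν I| ≤ ν.totalVariation.real U := by
  have hp := abs_integral_sub_measureReal_le ν.toJordanDecomposition.posPart
    (hf _ inferInstance) hI hU hfU
  have hn := abs_integral_sub_measureReal_le ν.toJordanDecomposition.negPart
    (hf _ inferInstance) hI hU hfU
  rw [ν.apply_eq_posPart_real_sub_negPart_real hI, sInt, SignedMeasure.totalVariation,
    measureReal_add_apply]
  rw [abs_le] at *
  constructor <;> linarith [hp.1, hp.2, hn.1, hn.2]

theorem NoMassAt.exists_isOpen_eventually_lt {μs : ℕ → SignedMeasure ℝ} {μ : SignedMeasure ℝ}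
    {x : ℝ} (h : NoMassAt μs x) (hx : μ {x} = 0) {ε : ℝ} (hε : 0 < ε) :
    ∃ N : Set ℝ, IsOpen N ∧ x ∈ N ∧ μ.totalVariation.real N < ε ∧
      ∀ᶠ n in atTop, (μs n).totalVariation.real N < ε := by
  obtain ⟨N, hNo, hxN, hN⟩ := h (ENNReal.ofReal (ε / 2)) (by simpa using hε)
  obtain ⟨M, hxM, hMo, hM⟩ := Set.exists_isOpen_lt_of_lt {x} (μ := μ.totalVariation)
    (ENNReal.ofReal ε)
    (by rw [totalVariation_singleton_eq_zero μ hx]; simpa using hε)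
  have hlt : ENNReal.ofReal (ε / 2) < ENNReal.ofReal ε :=
    (ENNReal.ofReal_lt_ofReal_iff hε).2 (by linarith)
  refine ⟨N ∩ M, hNo.inter hMo, ⟨hxN, hxM rfl⟩, ?_, ?_⟩
  · exact (ENNReal.lt_ofReal_iff_toReal_lt (measure_ne_top _ _)).1
      ((measure_mono Set.inter_subset_right).trans_lt hM)
  · filter_upwards [eventually_lt_of_limsup_lt (hN.trans_lt hlt)] with n hn
    exact (ENNReal.lt_ofReal_iff_toReal_lt (measure_ne_top _ _)).1
      ((measure_mono Set.inter_subset_left).trans_lt hn)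

theorem exists_continuous_abs_sub_indicator_Ioc_le {a b : ℝ} {A B : Set ℝ}
    (hA : IsOpen A) (hB : IsOpen B) (ha : a ∈ A) (hb : b ∈ B) :
    ∃ f : ℝ → ℝ, Continuous f ∧ HasCompactSupport f ∧
      ∀ y, |f y - (Set.Ioc a b).indicator 1 y| ≤ (A ∪ B).indicator 1 y := by
  have hV : IsOpen (A ∪ B ∪ Set.Ioo a b) := (hA.union hB).union isOpen_Ioo
  have hsub : Set.Icc a b ⊆ A ∪ B ∪ Set.Ioo a b := by
    intro y hy
    rcases hy.1.eq_or_lt with rfl | h1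
    · exact .inl (.inl ha)
    rcases hy.2.eq_or_lt with rfl | h2
    · exact .inl (.inr hb)
    exact .inr ⟨h1, h2⟩
  obtain ⟨f, hf1, hf0, hfc, hf⟩ := exists_continuous_one_zero_of_isCompact isCompact_Icc
    hV.isClosed_compl (Set.disjoint_compl_right_iff_subset.2 hsub)
  refine ⟨f, f.continuous, hfc, fun y ↦ ?_⟩
  by_cases hyI : y ∈ Set.Ioc a b
  · rw [Set.indicator_of_mem hyI, hf1 (Set.Ioc_subset_Icc_self hyI)]
    simpa using Set.indicator_apply_nonneg (s := A ∪ B) (f := (1 : ℝ → ℝ)) (a := y)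
      fun _ ↦ zero_le_one
  · rw [Set.indicator_of_notMem hyI, sub_zero, abs_of_nonneg (hf y).1]
    by_cases hyU : y ∈ A ∪ B
    · rw [Set.indicator_of_mem hyU]
      exact (hf y).2
    · rw [Set.indicator_of_notMem hyU, hf0]
      · rfl
      · rintro (h | h)
        exacts [hyU h, hyI (Set.Ioo_subset_Ioc_self h)]

theorem VagueTendsto.tendsto_apply_Ioc {μs : ℕ → SignedMeasure ℝ} {μ : SignedMeasure ℝ}
    (hvague : VagueTendsto μs μ) {a b : ℝ} (ha : μ {a} = 0) (hb : μ {b} = 0)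
    (hma : NoMassAt μs a) (hmb : NoMassAt μs b) :
    Tendsto (fun n ↦ μs n (Set.Ioc a b)) atTop (𝓝 (μ (Set.Ioc a b))) := by
  rw [Metric.tendsto_nhds]
  intro ε hε
  obtain ⟨A, hAo, haA, hA, hAn⟩ := hma.exists_isOpen_eventually_lt ha (ε := ε / 5) (by linarith)
  obtain ⟨B, hBo, hbB, hB, hBn⟩ := hmb.exists_isOpen_eventually_lt hb (ε := ε / 5) (by linarith)
  obtain ⟨f, hfc, hfs, hf⟩ := exists_continuous_abs_sub_indicator_Ioc_le hAo hBo haA hbB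
  have hbound (ν : SignedMeasure ℝ) : |sInt ν f - ν (Set.Ioc a b)| ≤
      ν.totalVariation.real A + ν.totalVariation.real B :=
    (abs_sInt_sub_apply_le ν (fun p _ ↦ hfc.integrable_of_hasCompactSupport hfs)
      measurableSet_Ioc (hAo.union hBo).measurableSet hf).trans (measureReal_union_le _ _)
  filter_upwards [hAn, hBn, Metric.tendsto_nhds.1 (hvague f hfc hfs) (ε / 5) (by linarith)]
    with n hnA hnB hn
  have h1 := abs_le.1 (hbound (μs n))
  have h2 := abs_le.1 (hbound μ)
  rw [Real.dist_eq, abs_lt] at *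
  constructor <;> linarith [h1.1, h1.2, h2.1, h2.2, hn.1, hn.2]

theorem stmt13 (α : ℝ) (μs : ℕ → SignedMeasure ℝ) (μ : SignedMeasure ℝ)
    (hvague : VagueTendsto μs μ)
    (hα : μ {α} = (0 : ℝ))
    (hnomass : ∀ x : ℝ, μ {x} = (0 : ℝ) → NoMassAt μs x) :
    ∀ x : ℝ, μ {x} = (0 : ℝ) →
      Tendsto (fun n => Fc (μs n) α x) atTop (𝓝 (Fc μ α x)) := by
  intro x hx
  unfold Fc
  split_ifs with h
  · exact hvague.tendsto_apply_Ioc hα hx (hnomass α hα) (hnomass x hx)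
  · exact (hvague.tendsto_apply_Ioc hx hα (hnomass x hx) (hnomass α hα)).neg
end
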